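/- arXiv:1603.08414 — 3 statements merged into one kernel-verified Lean document; each statement's English description precedes it below -/
import Mathlib

section
/- Let k ≥ 1 be an integer and let Φ : M₂(ℝ) → M₂(ℝ) be a map whose range contains every rank-one matrix. Then Φ satisfies [Φ(A), Φ(B)]_k = [A, B]_k for all A, B ∈ M₂(ℝ) if and only if there exist a function h : M₂(ℝ) → ℝ and a scalar λ ∈ ℝ with λ^{k+1} = 1 such that Φ(A) = λ·A + h(A)·I for all A ∈ M₂(ℝ). -/
/-- The k-commutator: `kComm 0 A B = A`, `kComm (k+1) A B = [kComm k A B, B]`. -/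
def kComm {𝔽 : Type*} [Field 𝔽] : ℕ → Matrix (Fin 2) (Fin 2) 𝔽 → Matrix (Fin 2) (Fin 2) 𝔽 → Matrix (Fin 2) (Fin 2) 𝔽
  | 0, A, _ => A
  | n + 1, A, B => kComm n A B * B - B * kComm n A B

section KCommutator

variable {𝔽 : Type*} [Field 𝔽] {A B C X : Matrix (Fin 2) (Fin 2) 𝔽}

theorem kComm_sub (n : ℕ) (A C B : Matrix (Fin 2) (Fin 2) 𝔽) :
    kComm n (A - C) B = kComm n A B - kComm n C B := by
  induction n with
  | zero => rfl
  | succ n ih => simp only [kComm, ih]; noncomm_ring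

theorem kComm_smul_left (n : ℕ) (l : 𝔽) (A B : Matrix (Fin 2) (Fin 2) 𝔽) :
    kComm n (l • A) B = l • kComm n A B := by
  induction n with
  | zero => rfl
  | succ n ih => simp only [kComm, ih, smul_mul_assoc, mul_smul_comm, smul_sub]

theorem kComm_succ_add_scalar (n : ℕ) (c : 𝔽) (A B : Matrix (Fin 2) (Fin 2) 𝔽) :
    kComm (n + 1) (A + c • 1) B = kComm (n + 1) A B := by
  induction n with
  | zero =>
    simp only [kComm, add_mul, mul_add, smul_mul_assoc, mul_smul_comm, one_mul, mul_one]
    abel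
  | succ n ih => rw [kComm, ih, ← kComm]

theorem kComm_smul_add_scalar_right (n : ℕ) (l c : 𝔽) (A B : Matrix (Fin 2) (Fin 2) 𝔽) :
    kComm n A (l • B + c • 1) = l ^ n • kComm n A B := by
  induction n with
  | zero => simp [kComm]
  | succ n ih =>
    simp only [kComm, ih, add_mul, mul_add, smul_mul_assoc, mul_smul_comm, one_mul, mul_one,
      pow_succ]
    module

theorem kComm_smul_add_scalar (n : ℕ) (l c d : 𝔽) (A B : Matrix (Fin 2) (Fin 2) 𝔽) :
    kComm (n + 1) (l • A + c • 1) (l • B + d • 1) = l ^ (n + 1 + 1) • kComm (n + 1) A B := by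
  rw [kComm_smul_add_scalar_right, kComm_succ_add_scalar, kComm_smul_left, smul_smul, ← pow_succ]

theorem trace_kComm_succ_mul (n : ℕ) (A B : Matrix (Fin 2) (Fin 2) 𝔽) :
    (kComm (n + 1) A B * B).trace = 0 := by
  rw [kComm, sub_mul, Matrix.trace_sub, Matrix.mul_assoc B, Matrix.trace_mul_comm B, sub_self]

theorem commutator_mul_eq_neg {d : 𝔽} (hB : B * B = d • 1) :
    (A * B - B * A) * B = -(B * (A * B - B * A)) := by
  have h : (A * B - B * A) * B + B * (A * B - B * A) = A * (B * B) - B * B * A := by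
    noncomm_ring
  rw [hB] at h
  exact eq_neg_of_add_eq_zero_left (by simpa using h)

theorem commute_of_kComm_succ_eq_zero [NeZero (2 : 𝔽)] {d : 𝔽} (hd : d ≠ 0)
    (hB : B * B = d • 1) (n : ℕ) (h : kComm (n + 1) A B = 0) : A * B = B * A := by
  induction n with
  | zero => exact sub_eq_zero.1 h
  | succ n ih =>
    refine ih ?_
    have hanti : kComm (n + 1) A B * B = -(B * kComm (n + 1) A B) := commutator_mul_eq_neg hB
    have hcomm : kComm (n + 1) A B * B - B * kComm (n + 1) A B = 0 := h
    generalize kComm (n + 1) A B = X at *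
    have h2 : (2 : 𝔽) • (X * B) = 0 := by
      rw [two_smul]
      nth_rewrite 2 [hanti]
      rw [← sub_eq_add_neg, hcomm]
    have hXB : X * B = 0 := (smul_eq_zero.1 h2).resolve_left two_ne_zero
    have hX : d • X = 0 := by
      rw [← Matrix.mul_one X, ← Matrix.mul_smul, ← hB, ← Matrix.mul_assoc, hXB, zero_mul]
    exact (smul_eq_zero.1 hX).resolve_left hd

theorem exists_kComm_eq [NeZero (2 : 𝔽)] {d : 𝔽} (hd : d ≠ 0) (hB : B * B = d • 1) (n : ℕ)
    (hX : X * B = -(B * X)) : ∃ Y, kComm n Y B = X := by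
  suffices ∃ Y, Y * B = -(B * Y) ∧ kComm n Y B = X from this.imp fun _ h => h.2
  induction n generalizing X with
  | zero => exact ⟨X, hX, rfl⟩
  | succ n ih =>
    have hBXB : B * (X * B) = -(X * B * B) := by
      rw [← Matrix.mul_assoc, ← neg_eq_iff_eq_neg, ← neg_mul, ← hX]
    obtain ⟨Y, hY, hYX⟩ := ih (X := (2 * d)⁻¹ • (X * B)) (by
      rw [smul_mul_assoc, mul_smul_comm, hBXB, smul_neg, neg_neg])
    refine ⟨Y, hY, ?_⟩
    rw [kComm, hYX, smul_mul_assoc, mul_smul_comm, hBXB, smul_neg, sub_neg_eq_add, ← two_smul 𝔽,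
      smul_smul, Matrix.mul_assoc, hB, Matrix.mul_smul, Matrix.mul_one, smul_smul]
    convert one_smul 𝔽 X
    have := two_ne_zero (α := 𝔽)
    field_simp

theorem commute_of_trace_kComm_mul_eq_zero [NeZero (2 : 𝔽)] {d : 𝔽} (hd : d ≠ 0)
    (hB : B * B = d • 1) (n : ℕ) (h : ∀ A, (kComm n A B * C).trace = 0) : B * C = C * B := by
  rw [← sub_eq_zero]
  refine Matrix.ext_iff_trace_mul_left.2 fun A => ?_
  obtain ⟨Y, hY⟩ := exists_kComm_eq hd hB n (commutator_mul_eq_neg (A := A) hB)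
  have := h Y
  rw [hY, sub_mul, Matrix.trace_sub, Matrix.mul_assoc B, Matrix.trace_mul_comm B] at this
  simpa [mul_sub, Matrix.mul_assoc] using this

theorem exists_eq_smul_add_scalar_of_commute (hB : B 0 1 ≠ 0) (h : B * C = C * B) :
    ∃ l c : 𝔽, C = l • B + c • 1 := by
  have h00 := congrFun (congrFun h 0) 0
  have h01 := congrFun (congrFun h 0) 1
  simp only [Matrix.mul_apply, Fin.sum_univ_two] at h00 h01
  refine ⟨C 0 1 / B 0 1, C 0 0 - C 0 1 / B 0 1 * B 0 0, ?_⟩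
  ext i j
  fin_cases i <;> fin_cases j <;> simp <;> field_simp
  · linear_combination h00
  · linear_combination h01

end KCommutator

/-- The traceless symmetric matrix with rows `(t, 1)` and `(1, -t)`. -/
def tracelessSymm (t : ℝ) : Matrix (Fin 2) (Fin 2) ℝ := !![t, 1; 1, -t]

theorem tracelessSymm_mul_self (t : ℝ) :
    tracelessSymm t * tracelessSymm t = (t ^ 2 + 1) • 1 := by
  ext i j
  fin_cases i <;> fin_cases j <;> simp [tracelessSymm, Matrix.mul_apply] <;> ring

theorem kComm_tracelessSymm_ne_zero (n : ℕ) {s t : ℝ} (hst : s ≠ t) :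
    kComm (n + 1) (tracelessSymm s) (tracelessSymm t) ≠ 0 := fun h => by
  have h := commute_of_kComm_succ_eq_zero (by positivity) (tracelessSymm_mul_self t) n h
  have h01 := congrFun (congrFun h 0) 1
  simp [tracelessSymm, Matrix.mul_apply] at h01
  exact hst (by linarith)

theorem eq_scalar_of_commute_tracelessSymm {M : Matrix (Fin 2) (Fin 2) ℝ}
    (h : ∀ t, M * tracelessSymm t = tracelessSymm t * M) : M = M 0 0 • 1 := by
  have e0 := congrFun (congrFun (h 0) 0) 0
  have e1 := congrFun (congrFun (h 0) 0) 1
  have e2 := congrFun (congrFun (h 1) 0) 1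
  simp [tracelessSymm, Matrix.mul_apply] at e0 e1 e2
  ext i j
  fin_cases i <;> fin_cases j <;> simp <;> linarith

theorem exists_map_tracelessSymm_eq {n : ℕ}
    {Φ : Matrix (Fin 2) (Fin 2) ℝ → Matrix (Fin 2) (Fin 2) ℝ}
    (hΦ : ∀ A B, kComm (n + 1) (Φ A) (Φ B) = kComm (n + 1) A B) (t : ℝ) :
    ∃ l c : ℝ, Φ (tracelessSymm t) = l • tracelessSymm t + c • 1 := by
  refine exists_eq_smul_add_scalar_of_commute (by simp [tracelessSymm])
    (commute_of_trace_kComm_mul_eq_zero (by positivity) (tracelessSymm_mul_self t) (n + 1) ?_)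
  intro A
  rw [← hΦ]
  exact trace_kComm_succ_mul n _ _

theorem strong_k_commutativity_preserving_real (k : ℕ) (hk : 1 ≤ k)
    (Φ : Matrix (Fin 2) (Fin 2) ℝ → Matrix (Fin 2) (Fin 2) ℝ)
    (hrange : ∀ T : Matrix (Fin 2) (Fin 2) ℝ, T.rank = 1 → ∃ A, Φ A = T) :
    (∀ A B : Matrix (Fin 2) (Fin 2) ℝ, kComm k (Φ A) (Φ B) = kComm k A B) ↔
      ∃ (h : Matrix (Fin 2) (Fin 2) ℝ → ℝ) (lam : ℝ), lam ^ (k + 1) = 1 ∧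
        ∀ A : Matrix (Fin 2) (Fin 2) ℝ, Φ A = lam • A + h A • 1 := by
  obtain ⟨n, rfl⟩ : ∃ n, k = n + 1 := ⟨k - 1, by omega⟩
  constructor
  · intro hΦ
    choose l c hl using exists_map_tracelessSymm_eq hΦ
    have hmul {s t : ℝ} (hst : s ≠ t) : l t ^ (n + 1) * l s = 1 := by
      have h := hΦ (tracelessSymm s) (tracelessSymm t)
      rw [hl, hl, kComm_smul_add_scalar_right, kComm_succ_add_scalar, kComm_smul_left,
        smul_smul] at h
      exact smul_left_injective ℝ (kComm_tracelessSymm_ne_zero n hst) (by simpa using h)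
    have hconst (s : ℝ) : l s = l 0 := by
      have h₁ : l (|s| + 1) ^ (n + 1) * l s = 1 := hmul (by linarith [le_abs_self s])
      have h₂ : l (|s| + 1) ^ (n + 1) * l 0 = 1 := hmul (by positivity)
      exact mul_left_cancel₀ (left_ne_zero_of_mul_eq_one h₁) (h₁.trans h₂.symm)
    have hpow : l 0 ^ (n + 1) * l 0 = 1 := by
      simpa only [hconst 1] using hmul (one_ne_zero (α := ℝ))
    refine ⟨fun A => (Φ A - l 0 • A) 0 0, l 0, hpow, fun A => ?_⟩
    rw [← sub_eq_iff_eq_add']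
    refine eq_scalar_of_commute_tracelessSymm fun t =>
      commute_of_kComm_succ_eq_zero (by positivity) (tracelessSymm_mul_self t) n ?_
    have h := hΦ A (tracelessSymm t)
    rw [hl, kComm_smul_add_scalar_right, hconst] at h
    rw [kComm_sub, kComm_smul_left, ← h, smul_smul, mul_comm, hpow, one_smul, sub_self]
  · rintro ⟨h, l, hl, hΦ⟩ A B
    rw [hΦ, hΦ, kComm_smul_add_scalar, hl, one_smul]
end

section
/- Let k ≥ 3 be an integer and let S ∈ M₂(ℝ). If [A, S]_k = 0 for every rank-one matrix A ∈ M₂(ℝ), then there exist a scalar λ ∈ ℝ and a matrix N ∈ M₂(ℝ) with N² = 0 such that S = λ·I + N. -/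
/-- Iterated commutators with a 2×2 matrix satisfy a recurrence of step two, whose factor is the
discriminant of the characteristic polynomial. -/
theorem kComm_add_three {𝔽 : Type*} [Field 𝔽] (n : ℕ) (A B : Matrix (Fin 2) (Fin 2) 𝔽) :
    kComm (n + 3) A B = (B.trace ^ 2 - 4 * B.det) • kComm (n + 1) A B := by
  simp only [kComm]
  generalize kComm n A B = X
  ext i j
  fin_cases i <;> fin_cases j <;>
    simp [Matrix.mul_apply, Fin.sum_univ_two, Matrix.trace_fin_two, Matrix.det_fin_two] <;> ring

theorem kComm_one_eq_zero_of_kComm_succ_eq_zero {𝔽 : Type*} [Field 𝔽]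
    {A B : Matrix (Fin 2) (Fin 2) 𝔽} (hB : B.trace ^ 2 - 4 * B.det ≠ 0) {n : ℕ}
    (h : kComm (n + 1) A B = 0) : kComm 1 A B = 0 := by
  induction n with
  | zero => exact h
  | succ n ih =>
    have h3 : kComm (n + 3) A B = 0 := by rw [kComm, h]; simp
    rw [kComm_add_three] at h3
    exact ih ((smul_eq_zero.mp h3).resolve_left hB)

theorem rank_single_one {𝔽 : Type*} [Field 𝔽] (i j : Fin 2) :
    (Matrix.single i j (1 : 𝔽)).rank = 1 := by
  apply le_antisymm
  · rw [Matrix.single_eq_single_vecMulVec_single]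
    exact Matrix.rank_vecMulVec_le _ _
  · rw [Nat.one_le_iff_ne_zero, Ne, Matrix.rank, Submodule.finrank_eq_zero, LinearMap.range_eq_bot]
    intro h
    have hij := congrFun (LinearMap.congr_fun h (Pi.single j 1)) i
    simp at hij

theorem kcomm_zero_implies_scalar_plus_nilpotent_real (k : ℕ) (hk : 3 ≤ k)
    (S : Matrix (Fin 2) (Fin 2) ℝ)
    (h : ∀ A : Matrix (Fin 2) (Fin 2) ℝ, A.rank = 1 → kComm k A S = 0) :
    ∃ (lam : ℝ) (N : Matrix (Fin 2) (Fin 2) ℝ), N * N = 0 ∧ S = lam • 1 + N := by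
  have hS : S.trace ^ 2 - 4 * S.det = 0 := by
    by_contra hne
    obtain ⟨n, rfl⟩ : ∃ n, k = n + 1 := ⟨k - 1, by omega⟩
    have hcomm (i j : Fin 2) : kComm 1 (Matrix.single i j 1) S = 0 :=
      kComm_one_eq_zero_of_kComm_succ_eq_zero hne (h _ (rank_single_one i j))
    have h01 : S 0 1 = 0 := by
      simpa [kComm, Matrix.mul_apply, Fin.sum_univ_two, Matrix.single_apply] using
        congrFun (congrFun (hcomm 0 0) 0) 1
    have hdiag : S 1 1 - S 0 0 = 0 := by
      simpa [kComm, Matrix.mul_apply, Fin.sum_univ_two, Matrix.single_apply] using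
        congrFun (congrFun (hcomm 0 1) 0) 1
    apply hne
    rw [Matrix.trace_fin_two, Matrix.det_fin_two]
    linear_combination (S 1 1 - S 0 0) * hdiag + 4 * S 1 0 * h01
  refine ⟨S.trace / 2, S - (S.trace / 2) • 1, ?_, by abel⟩
  rw [Matrix.trace_fin_two, Matrix.det_fin_two] at hS
  rw [Matrix.trace_fin_two]
  ext i j
  fin_cases i <;> fin_cases j <;>
    simp [Matrix.mul_apply, Fin.sum_univ_two] <;> first | ring1 | linear_combination hS / 4
end

section
/- Let 𝔽 be ℝ or ℂ, let k ≥ 1 be an integer, and let Φ : M₂(𝔽) → M₂(𝔽) be a map whose range contains every rank-one matrix and which satisfies [Φ(A), Φ(B)]_k = [A, B]_k for all A, B ∈ M₂(𝔽). Then for every A ∈ M₂(𝔽), the matrix Φ(A) is a scalar multiple of the identity if and only if A is a scalar multiple of the identity. -/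
theorem kComm_smul_one {𝔽 : Type*} [Field 𝔽] (c : 𝔽) (B : Matrix (Fin 2) (Fin 2) 𝔽) (n : ℕ) :
    kComm (n + 1) (c • 1) B = 0 := by
  induction n with
  | zero => simp [kComm]
  | succ n ih => rw [kComm, ih]; simp

theorem kComm_add_three_of_isIdempotentElem {𝔽 : Type*} [Field 𝔽]
    {A P : Matrix (Fin 2) (Fin 2) 𝔽} (hP : IsIdempotentElem P) (n : ℕ) :
    kComm (n + 3) A P = kComm (n + 1) A P := by
  have hP' : P * P = P := hP
  have hPX (X : Matrix (Fin 2) (Fin 2) 𝔽) : P * (P * X) = P * X := by rw [← mul_assoc, hP']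
  simp only [kComm, sub_mul, mul_sub, mul_assoc, hP', hPX]
  abel

theorem commute_of_kComm_eq_zero {𝔽 : Type*} [Field 𝔽] {A P : Matrix (Fin 2) (Fin 2) 𝔽}
    (hP : IsIdempotentElem P) {n : ℕ} (h : kComm (n + 1) A P = 0) : Commute A P := by
  induction n with
  | zero => exact sub_eq_zero.mp h
  | succ n ih =>
    apply ih
    rw [← kComm_add_three_of_isIdempotentElem hP, kComm, h]
    simp

theorem exists_eq_smul_one_of_kComm_eq_zero {𝔽 : Type*} [Field 𝔽] {A : Matrix (Fin 2) (Fin 2) 𝔽}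
    {n : ℕ} (h : ∀ P : Matrix (Fin 2) (Fin 2) 𝔽, P.rank = 1 → kComm (n + 1) A P = 0) :
    ∃ c : 𝔽, A = c • 1 := by
  have comm (x : 𝔽) : A * !![1, x; 0, 0] = !![1, x; 0, 0] * A := by
    refine commute_of_kComm_eq_zero (n := n) ?_ (h _ ?_)
    · ext i j; fin_cases i <;> fin_cases j <;> simp
    · have hv : (!![1, x; 0, 0] : Matrix (Fin 2) (Fin 2) 𝔽) =
          Matrix.vecMulVec ![1, 0] ![1, x] := by
        ext i j; fin_cases i <;> fin_cases j <;> simp [Matrix.vecMulVec_apply]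
      apply le_antisymm
      · rw [hv]
        exact Matrix.rank_vecMulVec_le _ _
      · rw [Nat.one_le_iff_ne_zero, Ne, Matrix.rank, Submodule.finrank_eq_zero,
          LinearMap.range_eq_bot]
        intro h0
        simpa using congrFun (LinearMap.congr_fun h0 ![1, 0]) 0
  have h0 := comm 0
  have h1 := comm 1
  have e01 := congrFun (congrFun h0 0) 1
  have e10 := congrFun (congrFun h0 1) 0
  have e11 := congrFun (congrFun h1 0) 1
  simp only [Matrix.mul_apply, Fin.sum_univ_two, Matrix.of_apply, Matrix.cons_val, mul_zero, mul_one,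
    zero_mul, one_mul, add_zero] at e01 e10 e11
  have e01' : A 0 1 = 0 := by grind
  have e10' : A 1 0 = 0 := by grind
  have e11' : A 1 1 = A 0 0 := by grind
  refine ⟨A 0 0, ?_⟩
  ext i j
  fin_cases i <;> fin_cases j <;> simp [e01', e10', e11']

theorem phi_preserves_scalar_matrices {𝔽 : Type*} [RCLike 𝔽] (k : ℕ) (hk : 1 ≤ k)
    (Φ : Matrix (Fin 2) (Fin 2) 𝔽 → Matrix (Fin 2) (Fin 2) 𝔽)
    (hrange : ∀ T : Matrix (Fin 2) (Fin 2) 𝔽, T.rank = 1 → ∃ A, Φ A = T)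
    (hpres : ∀ A B : Matrix (Fin 2) (Fin 2) 𝔽, kComm k (Φ A) (Φ B) = kComm k A B) :
    ∀ A : Matrix (Fin 2) (Fin 2) 𝔽,
      (∃ c : 𝔽, Φ A = c • 1) ↔ (∃ c : 𝔽, A = c • 1) := by
  obtain ⟨n, rfl⟩ := Nat.exists_eq_add_of_le' hk
  refine fun A => ⟨?_, ?_⟩
  · rintro ⟨c, hc⟩
    refine exists_eq_smul_one_of_kComm_eq_zero (n := n) fun P _ => ?_
    rw [← hpres, hc, kComm_smul_one]
  · rintro ⟨c, rfl⟩
    refine exists_eq_smul_one_of_kComm_eq_zero (n := n) fun P hP => ?_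
    obtain ⟨B, rfl⟩ := hrange P hP
    rw [hpres, kComm_smul_one]
end
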